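/- Let S = {a, a', b, b', c, c'} be a six-letter alphabet with complementation, let d ∈ {5, 6}, and let V, W ⊆ S^d be disjoint equivalent polybox codes without twin pairs with |V| ∈ {13,...,16} such that V is not flat. Then for every i ∈ [d] and every l ∈ S, if V^{i,l} ∪ V^{i,l'} ≠ ∅, then V^{i,l} ≠ ∅ and V^{i,l'} ≠ ∅. -/

import Mathlib

/-- The six-letter alphabet `S = {a, a', b, b', c, c'}` is modelled as `Fin 6` with
`a = 0, a' = 1, b = 2, b' = 3, c = 4, c' = 5`; the complementation swaps `0 ↔ 1`,
`2 ↔ 3`, `4 ↔ 5`. -/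
def compl6 : Fin 6 → Fin 6 := ![1, 0, 3, 2, 5, 4]

/-- Two words `u, v ∈ S^d` are dichotomous if `v j = (u j)'` for some coordinate `j`. -/
def Dichotomous {S : Type*} (c : S → S) {d : ℕ} (u v : Fin d → S) : Prop :=
  ∃ j, v j = c (u j)

/-- Two words form a twin pair if they differ by complementation at exactly one
coordinate and agree elsewhere. -/
def TwinPair {S : Type*} (c : S → S) {d : ℕ} (u v : Fin d → S) : Prop :=
  ∃ j, v j = c (u j) ∧ ∀ i, i ≠ j → u i = v i

/-- A polybox code: a set of pairwise dichotomous words. -/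
def PolyboxCode {S : Type*} (c : S → S) {d : ℕ} (V : Finset (Fin d → S)) : Prop :=
  ∀ u ∈ V, ∀ v ∈ V, u ≠ v → Dichotomous c u v

/-- A code without twin pairs. -/
def TwinPairFree {S : Type*} (c : S → S) {d : ℕ} (V : Finset (Fin d → S)) : Prop :=
  ∀ u ∈ V, ∀ v ∈ V, ¬ TwinPair c u v

/-- `ES`: the collection of all `B ⊆ S` containing exactly one letter from each
complementary pair `{s, s'}`. -/
def ESet {S : Type*} (c : S → S) : Set (Set S) :=
  {B | ∀ s : S, Xor' (s ∈ B) (c s ∈ B)}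

/-- The equicomplementary realization `v̆ = Ev₁ × ⋯ × Ev_d` of a word `v`,
where `Es = {B ∈ ES : s ∈ B}`. -/
def WordBox {S : Type*} (c : S → S) {d : ℕ} (v : Fin d → S) : Set (Fin d → Set S) :=
  {x | ∀ i, x i ∈ ESet c ∧ v i ∈ x i}

/-- `⋃ E(V)`, the union of the equicomplementary realizations of the words of `V`. -/
def CodeReal {S : Type*} (c : S → S) {d : ℕ} (V : Finset (Fin d → S)) :
    Set (Fin d → Set S) :=
  ⋃ v ∈ V, WordBox c v

/-- The word `w` is covered by the code `V`, i.e. `w̆ ⊆ ⋃ E(V)`. -/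
def Covered {S : Type*} (c : S → S) {d : ℕ} (w : Fin d → S)
    (V : Finset (Fin d → S)) : Prop :=
  WordBox c w ⊆ CodeReal c V

/-- Codes `V` and `W` are equivalent: `⋃ E(V) = ⋃ E(W)`. -/
def EquivalentCodes {S : Type*} (c : S → S) {d : ℕ} (V W : Finset (Fin d → S)) : Prop :=
  CodeReal c V = CodeReal c W

/-- A code is flat if all its words share the same fixed letter at some fixed
coordinate, i.e. `V = V^{i,l}` for some `i ∈ [d]` and `l ∈ S`. -/
def IsFlat {S : Type*} (c : S → S) {d : ℕ} (V : Finset (Fin d → S)) : Prop :=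
  ∃ i : Fin d, ∃ l : S, ∀ v ∈ V, v i = l


set_option linter.unusedSectionVars false
namespace PB

abbrev Lt := Fin 3 × Bool
def cp (l : Lt) : Lt := (l.1, !l.2)

@[simp] theorem cp_fst (l : Lt) : (cp l).1 = l.1 := rfl
@[simp] theorem cp_snd (l : Lt) : (cp l).2 = !l.2 := rfl
@[simp] theorem cp_cp (l : Lt) : cp (cp l) = l := by simp [cp]
theorem cp_ne (l : Lt) : cp l ≠ l := by
  intro h; have := congrArg Prod.snd h; simp at this
theorem ne_cp (l : Lt) : l ≠ cp l := (cp_ne l).symm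
theorem eq_or_cp {a b : Lt} (h : a.1 = b.1) : a = b ∨ a = cp b := by
  obtain ⟨a1, a2⟩ := a; obtain ⟨b1, b2⟩ := b
  simp only at h; subst h
  cases a2 <;> cases b2 <;> simp [cp]
theorem fst_ne {a b : Lt} (h : a ≠ b) (h' : a ≠ cp b) : a.1 ≠ b.1 := by
  intro e; rcases eq_or_cp e with e | e
  · exact h e
  · exact h' e

variable {ι : Type} [Fintype ι] [DecidableEq ι]

/-- the word `w` contains the point `z` -/
def M (w : ι → Lt) (z : ι → Fin 3 → Bool) : Prop := ∀ i, z i (w i).1 = (w i).2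

instance (w : ι → Lt) (z : ι → Fin 3 → Bool) : Decidable (M w z) := by
  unfold M; infer_instance

/-- force the letter `l` into coordinate `i` of `z` -/
def F (z : ι → Fin 3 → Bool) (i : ι) (l : Lt) : ι → Fin 3 → Bool :=
  Function.update z i (Function.update (z i) l.1 l.2)

theorem F_ne (z : ι → Fin 3 → Bool) {i t : ι} (l : Lt) (h : t ≠ i) : F z i l t = z t := by
  simp [F, h]
theorem F_self (z : ι → Fin 3 → Bool) (i : ι) (l : Lt) : F z i l i l.1 = l.2 := by
  simp [F]
theorem F_other (z : ι → Fin 3 → Bool) (i : ι) (l : Lt) {k : Fin 3} (h : k ≠ l.1) :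
    F z i l i k = z i k := by
  simp [F, h]
theorem F_eq (z : ι → Fin 3 → Bool) (i : ι) (l : Lt) (h : z i l.1 = l.2) : F z i l = z := by
  simp [F, ← h]
theorem F_F (z : ι → Fin 3 → Bool) (i : ι) (l g : Lt) (h : l.1 = g.1) :
    F (F z i l) i g = F z i g := by
  simp [F, h]
theorem F_cases (z : ι → Fin 3 → Bool) (i : ι) (l : Lt) : F z i l = z ∨ F z i (cp l) = z := by
  rcases Bool.eq_or_eq_not (z i l.1) l.2 with h | h
  · exact Or.inl (F_eq z i l h)
  · exact Or.inr (F_eq z i (cp l) (by simpa using h))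

theorem M_F_other {w : ι → Lt} {z : ι → Fin 3 → Bool} {i : ι} {l : Lt} (h : (w i).1 ≠ l.1) :
    M w (F z i l) ↔ M w z := by
  apply forall_congr'; intro t
  by_cases ht : t = i
  · subst ht; rw [F_other _ _ _ h]
  · rw [F_ne _ _ ht]

theorem M_F_ne {w : ι → Lt} {z : ι → Fin 3 → Bool} {i : ι} {l : Lt} (h : M w (F z i l)) :
    w i ≠ cp l := by
  intro e
  have := h i
  rw [e] at this
  simp only [cp_fst, F_self, cp_snd] at this
  simp at this

theorem M_ne {w : ι → Lt} {z : ι → Fin 3 → Bool} {i : ι} {l : Lt} (h : M w z)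
    (hl : z i l.1 = l.2) : w i ≠ cp l := by
  rw [← F_eq z i l hl] at h; exact M_F_ne h

theorem M_F {w : ι → Lt} {z : ι → Fin 3 → Bool} {i : ι} {l : Lt} (h : M w z)
    (hl : w i ≠ cp l) : M w (F z i l) := by
  by_cases e : w i = l
  · have := h i
    rw [e] at this
    rwa [F_eq z i l this]
  · exact (M_F_other (fst_ne e hl)).2 h

theorem M_update {w : ι → Lt} {z : ι → Fin 3 → Bool} {i : ι} {l : Lt} :
    M (Function.update w i l) z ↔ z i l.1 = l.2 ∧ ∀ t, t ≠ i → z t (w t).1 = (w t).2 := by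
  constructor
  · intro h
    refine ⟨by simpa using h i, fun t ht => by simpa [ht] using h t⟩
  · rintro ⟨h1, h2⟩ t
    by_cases ht : t = i
    · subst ht; simpa using h1
    · simpa [ht] using h2 t ht

theorem M_update_F {w : ι → Lt} {z : ι → Fin 3 → Bool} {i : ι} {l : Lt} :
    M (Function.update w i l) (F z i l) ↔ ∀ t, t ≠ i → z t (w t).1 = (w t).2 := by
  rw [M_update]
  constructor
  · rintro ⟨_, h⟩ t ht; have := h t ht; rwa [F_ne _ _ ht] at this
  · intro h; refine ⟨F_self _ _ _, fun t ht => ?_⟩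
    rw [F_ne _ _ ht]; exact h t ht

theorem M_self_F {w : ι → Lt} {z : ι → Fin 3 → Bool} {i : ι} {l : Lt} (hw : w i = l) :
    M w (F z i l) ↔ ∀ t, t ≠ i → z t (w t).1 = (w t).2 := by
  have : Function.update w i l = w := by rw [← hw]; simp
  rw [← M_update_F (l := l), this]

/-- counting function -/
def cnt (X : Multiset (ι → Lt)) (z : ι → Fin 3 → Bool) : ℕ := X.countP (fun w => M w z)

theorem cnt_add (X Y : Multiset (ι → Lt)) (z) : cnt (X + Y) z = cnt X z + cnt Y z :=
  Multiset.countP_add _ _ _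

theorem cnt_pos {X : Multiset (ι → Lt)} {z} : 0 < cnt X z ↔ ∃ x ∈ X, M x z :=
  Multiset.countP_pos

theorem cnt_zero {X : Multiset (ι → Lt)} {z} : cnt X z = 0 ↔ ∀ x ∈ X, ¬ M x z :=
  Multiset.countP_eq_zero

theorem card_cnt (X : Multiset (ι → Lt)) :
    ∑ z, cnt X z = X.card * 4 ^ (Fintype.card ι) := by
  have key : ∀ w : ι → Lt, (Finset.univ.filter (fun z => M w z)).card = 4 ^ (Fintype.card ι) := by
    intro w
    have : Finset.univ.filter (fun z => M w z) =
        Fintype.piFinset (fun i => Finset.univ.filter (fun p : Fin 3 → Bool => p (w i).1 = (w i).2)) := by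
      ext z
      simp only [Finset.mem_filter, Finset.mem_univ, true_and, Fintype.mem_piFinset]
      rfl
    rw [this, Fintype.card_piFinset]
    have h4 : ∀ l : Lt, (Finset.univ.filter (fun p : Fin 3 → Bool => p l.1 = l.2)).card = 4 := by
      decide
    simp [h4]
  induction X using Multiset.induction_on with
  | empty => simp [cnt]
  | cons w X ih =>
    have : ∀ z, cnt (w ::ₘ X) z = cnt X z + if M w z then 1 else 0 := by
      intro z; unfold cnt; rw [Multiset.countP_cons]
    simp only [this, Finset.sum_add_distrib, ih, Multiset.card_cons, add_mul, one_mul]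
    rw [← key w, Finset.card_filter]

theorem card_eq {X Y : Multiset (ι → Lt)} (h : ∀ z, cnt X z = cnt Y z) : X.card = Y.card := by
  have h1 := card_cnt X
  have h2 := card_cnt Y
  rw [Finset.sum_congr rfl (fun z _ => h z), h2] at h1
  exact (Nat.eq_of_mul_eq_mul_right (by positivity) h1).symm

/-- decomposition -/
def cl (X : Multiset (ι → Lt)) (i : ι) (l : Lt) (z : ι → Fin 3 → Bool) : ℕ :=
  cnt (X.filter (fun w => w i = l)) (F z i l)

def rs (X : Multiset (ι → Lt)) (i : ι) (k : Fin 3) (z : ι → Fin 3 → Bool) : ℕ :=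
  cnt (X.filter (fun w => (w i).1 ≠ k)) z

theorem rs_F (X : Multiset (ι → Lt)) (i : ι) (l : Lt) (k : Fin 3) (hk : k = l.1) (z) :
    cnt (X.filter (fun w => (w i).1 ≠ k)) (F z i l) = rs X i k z := by
  subst hk
  unfold rs cnt
  rw [Multiset.countP_filter, Multiset.countP_filter]
  apply Multiset.countP_congr rfl
  intro w _
  apply propext
  constructor
  · rintro ⟨a, b⟩; exact ⟨(M_F_other b).1 a, b⟩
  · rintro ⟨a, b⟩; exact ⟨(M_F_other b).2 a, b⟩

theorem cl_def (X : Multiset (ι → Lt)) (i : ι) (l : Lt) (z) :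
    cnt (X.filter (fun w => w i = l)) (F z i l) = cl X i l z := rfl

theorem cl_zero (X : Multiset (ι → Lt)) (i : ι) (l : Lt) (z) :
    cnt (X.filter (fun w => w i = l)) (F z i (cp l)) = 0 := by
  rw [cnt_zero]; intro x hx hM
  rw [Multiset.mem_filter] at hx
  exact M_F_ne hM (by rw [cp_cp]; exact hx.2)

theorem cl_zero' (X : Multiset (ι → Lt)) (i : ι) (l : Lt) (z) :
    cnt (X.filter (fun w => w i = cp l)) (F z i l) = 0 := by
  have := cl_zero X i (cp l) z; rwa [cp_cp] at this

theorem cnt_F (X : Multiset (ι → Lt)) (i : ι) (l : Lt) (z) :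
    cnt X (F z i l) = cl X i l z + rs X i l.1 z := by
  rw [← rs_F X i l l.1 rfl z]
  unfold cl cnt
  rw [Multiset.countP_filter, Multiset.countP_filter,
    Multiset.countP_eq_countP_filter_add X (fun w => M w (F z i l)) (fun w => w i = l),
    Multiset.countP_filter, Multiset.countP_filter]
  congr 1
  apply Multiset.countP_congr rfl
  intro w _
  apply propext
  constructor
  · rintro ⟨a, b⟩; exact ⟨a, fst_ne b (M_F_ne a)⟩
  · rintro ⟨a, b⟩; exact ⟨a, fun e => b (by rw [e])⟩

theorem cnt_map (X : Multiset (ι → Lt)) (i : ι) (l g : Lt) (z) :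
    cnt ((X.filter (fun w => w i = l)).map (fun w => Function.update w i g)) (F z i g)
      = cl X i l z := by
  unfold cl cnt
  rw [Multiset.countP_map, ← Multiset.countP_eq_card_filter]
  apply Multiset.countP_congr rfl
  intro w hw
  rw [Multiset.mem_filter] at hw
  apply propext
  rw [M_update_F, M_self_F hw.2]

theorem cnt_map_zero (X : Multiset (ι → Lt)) (i : ι) (g : Lt) (z) :
    cnt (X.map (fun w => Function.update w i g)) (F z i (cp g)) = 0 := by
  rw [cnt_zero]; intro x hx hM
  rw [Multiset.mem_map] at hx
  obtain ⟨w, _, rfl⟩ := hx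
  exact M_F_ne hM (by simp)

theorem cnt_map_zero' (X : Multiset (ι → Lt)) (i : ι) (g : Lt) (z) :
    cnt (X.map (fun w => Function.update w i (cp g))) (F z i g) = 0 := by
  have := cnt_map_zero X i (cp g) z; rwa [cp_cp] at this

theorem cnt_ext {X Y : Multiset (ι → Lt)} (i : ι) (l : Lt)
    (h1 : ∀ z, cnt X (F z i l) = cnt Y (F z i l))
    (h2 : ∀ z, cnt X (F z i (cp l)) = cnt Y (F z i (cp l))) : ∀ z, cnt X z = cnt Y z := by
  intro z
  rcases F_cases z i l with h | h
  · rw [← h]; exact h1 z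
  · rw [← h]; exact h2 z

/-- slices -/
def Sl (X : Multiset (ι → Lt)) (i : ι) (p : Fin 3 → Bool) (g : Lt) : Multiset (ι → Lt) :=
  (X.filter (fun w => p (w i).1 = (w i).2)).map (fun w => Function.update w i g)

theorem cnt_Sl {X Y : Multiset (ι → Lt)} (i : ι) (p : Fin 3 → Bool) (g : Lt)
    (h : ∀ z, cnt X z = cnt Y z) : ∀ z, cnt (Sl X i p g) z = cnt (Sl Y i p g) z := by
  have key : ∀ X : Multiset (ι → Lt), ∀ z,
      cnt (Sl X i p g) (F z i g) = cnt X (Function.update z i p) := by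
    intro X z
    unfold Sl cnt
    rw [Multiset.countP_map, ← Multiset.countP_eq_card_filter, Multiset.countP_filter]
    apply Multiset.countP_congr rfl
    intro w _
    apply propext
    rw [M_update_F]
    constructor
    · rintro ⟨a, b⟩ t
      by_cases ht : t = i
      · subst ht; simpa using b
      · simpa [ht] using a t ht
    · intro a
      refine ⟨fun t ht => by simpa [ht] using a t, by simpa using a i⟩
  refine cnt_ext i g (fun z => ?_) (fun z => ?_)
  · rw [key, key, h]
  · unfold Sl; rw [cnt_map_zero, cnt_map_zero]

theorem Sl_eq {X : Multiset (ι → Lt)} {i : ι} {p : Fin 3 → Bool} {g : Lt}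
    (hg : p g.1 = g.2) (h : ∀ x ∈ X, p (x i).1 = (x i).2 → x i = g) :
    X.filter (fun w => w i = g) = Sl X i p g := by
  unfold Sl
  have e : X.filter (fun w => p (w i).1 = (w i).2) = X.filter (fun w => w i = g) := by
    apply Multiset.filter_congr
    intro x hx
    exact ⟨h x hx, fun e => by rw [e]; exact hg⟩
  rw [e]
  conv_lhs => rw [← Multiset.map_id (X.filter (fun w => w i = g))]
  apply Multiset.map_congr rfl
  intro x hx
  rw [Multiset.mem_filter] at hx
  rw [← hx.2]; simp

/-- codes -/
def Code (X : Finset (ι → Lt)) : Prop := ∀ x ∈ X, ∀ y ∈ X, ∀ z, M x z → M y z → x = y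
def TF (X : Finset (ι → Lt)) : Prop := ∀ x ∈ X, ∀ j, Function.update x j (cp (x j)) ∉ X
def Cov (X : Finset (ι → Lt)) (u : ι → Lt) : Prop := ∀ z, M u z → ∃ x ∈ X, M x z
def Mt (x u : ι → Lt) : Prop := ∃ z, M x z ∧ M u z

theorem Code.mono {X Y : Finset (ι → Lt)} (h : Code X) (hs : Y ⊆ X) : Code Y :=
  fun x hx y hy => h x (hs hx) y (hs hy)
theorem TF.mono {X Y : Finset (ι → Lt)} (h : TF X) (hs : Y ⊆ X) : TF Y :=
  fun x hx j hy => h x (hs hx) j (hs hy)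

/-- forcing all the letters of u -/
def FA (z : ι → Fin 3 → Bool) (u : ι → Lt) : ι → Fin 3 → Bool :=
  fun t => Function.update (z t) (u t).1 (u t).2

theorem M_FA (z : ι → Fin 3 → Bool) (u : ι → Lt) : M u (FA z u) := by
  intro t; simp [FA]
theorem FA_other (z : ι → Fin 3 → Bool) (u : ι → Lt) (t : ι) (l : Lt) (h : z t l.1 = l.2)
    (hl : l ≠ cp (u t)) : FA z u t l.1 = l.2 := by
  by_cases e : l = u t
  · subst e; simp [FA]
  · simp [FA, fst_ne e hl, h]

theorem Mt_ne {x u : ι → Lt} (h : Mt x u) (t : ι) : x t ≠ cp (u t) := by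
  obtain ⟨z, h1, h2⟩ := h
  exact M_ne h1 (h2 t)

theorem Mt_of {x u : ι → Lt} (h : ∀ t, x t ≠ cp (u t)) : Mt x u := by
  refine ⟨FA (fun t k => (x t).2) u, ?_, M_FA _ _⟩
  intro t
  exact FA_other _ _ _ _ rfl (h t)

theorem exM (u : ι → Lt) : ∃ z, M u z := ⟨FA (fun _ _ => true) u, M_FA _ _⟩

end PB

namespace PB
variable {ι : Type} [Fintype ι] [DecidableEq ι]

theorem Wcov {Y : Finset (ι → Lt)} {u w : ι → Lt} {j : ι} {b : Lt} (hY : Code Y)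
    (hb : b.1 ≠ (u j).1)
    (hinv : ∀ z, M u z → (∃ x ∈ Y, M x z) → ∀ g : Lt, g.1 = b.1 → ∃ x ∈ Y, M x (F z j g))
    (hw : w ∈ Y) (hwj : w j = b) (hwu : Mt w u)
    (huniq : ∀ x ∈ Y, x j = b → Mt x u → x = w) :
    Cov (Y.filter (fun x => x j = cp b)) (Function.update w j (cp b)) := by
  intro z hz
  rw [M_update] at hz
  obtain ⟨hzj, hzt⟩ := hz
  have huF : ∀ z g, g.1 = b.1 → M u z → M u (F z j g) := fun z g hg h =>
    (M_F_other (by rw [hg]; exact hb.symm)).2 h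
  have hu1 : M u (F (FA z u) j b) := huF _ _ rfl (M_FA z u)
  have hw1 : M w (F (FA z u) j b) := by
    rw [M_self_F hwj]
    intro t ht
    exact FA_other _ _ _ _ (hzt t ht) (Mt_ne hwu t)
  obtain ⟨x0, hx0, hm0⟩ := hinv _ hu1 ⟨w, hw, hw1⟩ (cp b) rfl
  have hu2 := huF _ (cp b) rfl hu1
  have hxb : x0 j ≠ b := by
    have := M_F_ne hm0; rwa [cp_cp] at this
  have hxj : x0 j = cp b := by
    by_contra h
    have h2 : (x0 j).1 ≠ b.1 := fst_ne hxb h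
    have := hY x0 hx0 w hw _ ((M_F_other (l := cp b) (by exact h2)).1 hm0) hw1
    rw [this] at hxb; exact hxb hwj
  refine ⟨x0, Finset.mem_filter.2 ⟨hx0, hxj⟩, ?_⟩
  intro t
  by_cases ht : t = j
  · subst ht; rw [hxj]; exact hzj
  have hP : F (F (FA z u) j b) j (cp b) t = FA z u t := by rw [F_ne _ _ ht, F_ne _ _ ht]
  by_cases hwt : w t = u t
  · have := hm0 t
    rw [hP] at this
    have e : FA z u t = z t := by
      unfold FA; rw [← hwt, ← hzt t ht]; simp
    rwa [e] at this
  · have hxt : x0 t = w t := by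
      by_contra hne
      set P := F (F (FA z u) j b) j (cp b) with hPdef
      have hPw : P t (w t).1 = (w t).2 := by
        rw [hP]; exact FA_other _ _ _ _ (hzt t ht) (Mt_ne hwu t)
      have p1 : (x0 t).1 ≠ (w t).1 := fst_ne hne (M_ne hm0 hPw)
      have p2 : (w t).1 ≠ (u t).1 := fst_ne hwt (Mt_ne hwu t)
      have hx1 : M x0 (F P t (cp (w t))) := (M_F_other (by exact p1)).2 hm0
      have hu3 : M u (F P t (cp (w t))) := (M_F_other (by exact p2.symm)).2 hu2
      obtain ⟨x1, hx1Y, hm1⟩ := hinv _ hu3 ⟨x0, hx0, hx1⟩ b rfl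
      have hu4 := huF _ b rfl hu3
      have h1j : x1 j = b := by
        by_contra h
        have h2 : (x1 j).1 ≠ b.1 := fst_ne h (M_F_ne hm1)
        have := hY x1 hx1Y x0 hx0 _ ((M_F_other h2).1 hm1) hx1
        rw [this, hxj] at h2; exact h2 rfl
      have := huniq x1 hx1Y h1j ⟨_, hm1, hu4⟩
      subst this
      have h5 := hm1 t
      rw [F_ne _ _ ht] at h5
      have h6 := F_self P t (cp (x1 t))
      rw [cp_fst] at h6
      rw [h6] at h5
      simp at h5
    rw [hxt]; exact hzt t ht

theorem Cov.inv {X : Finset (ι → Lt)} {u : ι → Lt} (h : Cov X u) {j : ι} {b : Lt}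
    (hb : b.1 ≠ (u j).1) :
    ∀ z, M u z → (∃ x ∈ X, M x z) → ∀ g : Lt, g.1 = b.1 → ∃ x ∈ X, M x (F z j g) := by
  intro z hz _ g hg
  exact h _ ((M_F_other (by rw [hg]; exact hb.symm)).2 hz)

theorem N0 {X : Finset (ι → Lt)} {u x : ι → Lt} {i : ι} {a : Lt} (hX : Code X) (hc : Cov X u)
    (hx : x ∈ X) (hxi : x i = a) (ha : a.1 ≠ (u i).1) (hm : Mt x u) :
    ∃ y ∈ X, y i = cp a ∧ Mt y u := by
  obtain ⟨z, hz1, hz2⟩ := hm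
  have hu : M u (F z i (cp a)) := (M_F_other (by exact ha.symm)).2 hz2
  obtain ⟨y, hy, hyz⟩ := hc _ hu
  refine ⟨y, hy, ?_, _, hyz, hu⟩
  by_contra h
  have h1 : y i ≠ a := by have := M_F_ne hyz; rwa [cp_cp] at this
  have h2 : (y i).1 ≠ a.1 := fst_ne h1 h
  have := hX y hy x hx z ((M_F_other (l := cp a) (by exact h2)).1 hyz) hz1
  rw [this] at h1; exact h1 hxi

theorem filt {X : Finset (ι → Lt)} {i : ι} {a : Lt} {w : ι → Lt}
    (hX : TF X) (hwi : w i = a) (hw : w ∈ X)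
    (h : Function.update w i (cp a) ∈ X.filter (fun x => x i = cp a)) : False := by
  subst hwi
  exact hX w hw i (Finset.mem_filter.1 h).1

theorem L5 : ∀ (n : ℕ) (X : Finset (ι → Lt)) (u : ι → Lt), X.card = n → n ≤ 4 → Code X → TF X →
    Cov X u → u ∈ X := by
  intro n
  induction n using Nat.strong_induction_on with
  | _ n ih =>
  intro X u hn h4 hX hT hc
  by_contra hu
  obtain ⟨z0, hz0⟩ := exM u
  obtain ⟨x, hx, hxz⟩ := hc z0 hz0
  have hxu : Mt x u := ⟨z0, hxz, hz0⟩
  have hne : x ≠ u := fun e => hu (e ▸ hx)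
  obtain ⟨j, hj⟩ := Function.ne_iff.1 hne
  have hb : (x j).1 ≠ (u j).1 := fst_ne hj (Mt_ne hxu j)
  classical
  have key : ∀ g : Lt, g.1 = (x j).1 → ∀ w ∈ X, w j = g → Mt w u →
      2 ≤ (X.filter (fun x => x j = g ∧ Mt x u)).card := by
    intro g hg w hw hwj hwu
    by_contra hlt
    have hgu : g.1 ≠ (u j).1 := by rw [hg]; exact hb
    have hwB : w ∈ X.filter (fun x => x j = g ∧ Mt x u) := Finset.mem_filter.2 ⟨hw, hwj, hwu⟩
    have hu1 : ∀ y ∈ X, y j = g → Mt y u → y = w := by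
      intro y hy hyj hyu
      have : y ∈ X.filter (fun x => x j = g ∧ Mt x u) := Finset.mem_filter.2 ⟨hy, hyj, hyu⟩
      exact Finset.card_le_one.1 (by omega) _ this _ hwB
    have := Wcov hX hgu (hc.inv hgu) hw hwj hwu hu1
    have hlt2 : (X.filter (fun x => x j = cp g)).card < n := by
      rw [← hn]
      apply Finset.card_lt_card
      refine Finset.filter_ssubset.2 ⟨w, hw, ?_⟩
      rw [hwj]; exact ne_cp g
    exact filt hT hwj hw (ih _ hlt2 _ _ rfl (by omega) (hX.mono (Finset.filter_subset _ _))
      (hT.mono (Finset.filter_subset _ _)) this)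
  have k1 := key (x j) rfl x hx rfl hxu
  obtain ⟨y, hy, hyj, hyu⟩ := N0 hX hc hx rfl hb hxu
  have k2 := key (cp (x j)) rfl y hy hyj hyu
  set B1 := X.filter (fun t => t j = x j ∧ Mt t u) with hB1
  set B2 := X.filter (fun t => t j = cp (x j) ∧ Mt t u) with hB2
  have hd : Disjoint B1 B2 := by
    rw [Finset.disjoint_left]
    intro t h1 h2
    have e1 := (Finset.mem_filter.1 h1).2.1
    have e2 := (Finset.mem_filter.1 h2).2.1
    exact ne_cp (x j) (e1.symm.trans e2)
  have hU : B1 ∪ B2 = X := by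
    apply Finset.eq_of_subset_of_card_le
    · exact Finset.union_subset (Finset.filter_subset _ _) (Finset.filter_subset _ _)
    · rw [Finset.card_union_of_disjoint hd]; omega
  have hall : ∀ t ∈ X, t j = x j ∨ t j = cp (x j) := by
    intro t ht
    rw [← hU, Finset.mem_union] at ht
    rcases ht with h | h
    · exact Or.inl (Finset.mem_filter.1 h).2.1
    · exact Or.inr (Finset.mem_filter.1 h).2.1
  have fin : ∀ g : Lt, g.1 = (x j).1 → ∀ w ∈ X, w j = cp g → Function.update u j g ∈ X := by
    intro g hg w hw hwj
    have hc' : Cov (X.filter (fun x => x j = g)) (Function.update u j g) := by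
      intro z hz
      have hz' := M_update.1 hz
      have huz : M u (F z j (u j)) := (M_self_F rfl).2 hz'.2
      obtain ⟨t, ht, htz⟩ := hc _ huz
      have hg1 : (t j).1 = g.1 := by
        rcases hall t ht with h | h <;> rw [h, hg] <;> rfl
      have htz' : M t z := (M_F_other (by rw [hg1, hg]; exact hb)).1 htz
      refine ⟨t, Finset.mem_filter.2 ⟨ht, ?_⟩, htz'⟩
      rcases eq_or_cp hg1 with h | h
      · exact h
      · exact absurd h (M_ne htz' hz'.1)
    have hlt2 : (X.filter (fun x => x j = g)).card < n := by
      rw [← hn]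
      apply Finset.card_lt_card
      refine Finset.filter_ssubset.2 ⟨w, hw, ?_⟩
      rw [hwj]; exact cp_ne g
    exact (Finset.mem_filter.1 (ih _ hlt2 _ _ rfl (by omega) (hX.mono (Finset.filter_subset _ _))
      (hT.mono (Finset.filter_subset _ _)) hc')).1
  have f1 := fin (x j) rfl y hy hyj
  have f2 := fin (cp (x j)) rfl x hx (cp_cp _).symm
  apply hT _ f1 j
  simpa using f2

theorem N2 {X : Finset (ι → Lt)} {u x : ι → Lt} {i : ι} {a : Lt} (hX : Code X) (hT : TF X)
    (hc : Cov X u)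
    (hx : x ∈ X) (hxi : x i = a) (ha : a.1 ≠ (u i).1) (hm : Mt x u)
    (h4 : (X.filter (fun x => x i = cp a)).card ≤ 4) :
    ∃ y ∈ X, y ≠ x ∧ y i = a ∧ Mt y u := by
  by_contra hno
  have hu1 : ∀ y ∈ X, y i = a → Mt y u → y = x := by
    intro y hy hyj hyu
    by_contra h
    exact hno ⟨y, hy, h, hyj, hyu⟩
  have := Wcov hX ha (hc.inv ha) hx hxi hm hu1
  exact filt hT hxi hx (L5 _ _ _ rfl h4 (hX.mono (Finset.filter_subset _ _))
      (hT.mono (Finset.filter_subset _ _)) this)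

theorem PP {X : Finset (ι → Lt)} {u : ι → Lt} {i : ι} (hX : Code X) (hT : TF X)
    (hc : Cov X u) (hu : u ∉ X) (h4 : (X.filter (fun x => x i = u i)).card ≤ 4) :
    ∃ x ∈ X, (x i).1 ≠ (u i).1 ∧ Mt x u := by
  by_contra hno
  apply hu
  have : Cov (X.filter (fun x => x i = u i)) u := by
    intro z hz
    obtain ⟨x, hx, hxz⟩ := hc z hz
    refine ⟨x, Finset.mem_filter.2 ⟨hx, ?_⟩, hxz⟩
    by_contra h
    exact hno ⟨x, hx, fst_ne h (M_ne hxz (hz i)), z, hxz, hz⟩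
  exact (Finset.mem_filter.1 (L5 _ _ _ rfl h4 (hX.mono (Finset.filter_subset _ _))
      (hT.mono (Finset.filter_subset _ _)) this)).1
end PB

namespace PB
variable {ι : Type} [Fintype ι] [DecidableEq ι]

theorem eqs {X U : Multiset (ι → Lt)} (h : ∀ z, cnt U z = cnt X z) (i : ι) (l : Lt) (z) :
    cl U i l z + rs U i l.1 z = cl X i l z + rs X i l.1 z := by
  rw [← cnt_F, ← cnt_F, h]

theorem cl_none {X : Multiset (ι → Lt)} {i : ι} {l : Lt} (h : ∀ x ∈ X, x i ≠ l) (z) :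
    cl X i l z = 0 := by
  unfold cl; rw [cnt_zero]; intro x hx
  rw [Multiset.mem_filter] at hx
  exact absurd hx.2 (h x hx.1)

theorem G1 {X U : Multiset (ι → Lt)} (h : ∀ z, cnt U z = cnt X z) {i : ι} {l : Lt}
    (hl : ∀ x ∈ X, x i ≠ cp l) : ∀ z,
    cnt (U.filter (fun w => (w i).1 ≠ l.1) + U.filter (fun w => w i = cp l) +
      (U.filter (fun w => w i = cp l)).map (fun w => Function.update w i l)) z =
    cnt (X.filter (fun w => (w i).1 ≠ l.1)) z := by
  refine cnt_ext i l (fun z => ?_) (fun z => ?_)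
  · rw [cnt_add, cnt_add, rs_F _ _ _ _ rfl, rs_F _ _ _ _ rfl, cnt_map, cl_zero']
    have := eqs h i (cp l) z
    rw [cl_none hl, cp_fst] at this
    omega
  · rw [cnt_add, cnt_add, rs_F _ _ _ _ (cp_fst l).symm, rs_F _ _ _ _ (cp_fst l).symm, cnt_map_zero,
      cl_def]
    have := eqs h i (cp l) z
    rw [cl_none hl, cp_fst] at this
    omega

theorem G2 {X U : Multiset (ι → Lt)} (h : ∀ z, cnt U z = cnt X z) {i : ι} {l : Lt}
    (hl : ∀ x ∈ X, x i ≠ cp l) (hl' : ∀ x ∈ U, x i ≠ cp l) : ∀ z,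
    cnt (U.filter (fun w => w i = l)) z = cnt (X.filter (fun w => w i = l)) z := by
  refine cnt_ext i l (fun z => ?_) (fun z => ?_)
  · rw [cl_def, cl_def]
    have := eqs h i (cp l) z
    have h2 := eqs h i l z
    rw [cl_none hl, cl_none hl', cp_fst] at this
    omega
  · rw [cl_zero, cl_zero]

theorem G3 {X U : Multiset (ι → Lt)} (h : ∀ z, cnt U z = cnt X z) {i : ι} {b : Lt}
    (hl : ∀ x ∈ U, x i ≠ b) : ∀ z,
    cnt (U.filter (fun w => w i = cp b) +
      (X.filter (fun w => w i = b)).map (fun w => Function.update w i (cp b))) z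
    = cnt (X.filter (fun w => w i = cp b)) z := by
  refine cnt_ext i b (fun z => ?_) (fun z => ?_)
  · rw [cnt_add, cnt_map_zero', cl_zero', cl_zero']
  · rw [cnt_add, cnt_map, cl_def, cl_def]
    have := eqs h i (cp b) z
    have h2 := eqs h i b z
    rw [cl_none hl] at h2
    rw [cp_fst] at this
    omega

theorem exP : ∀ g h : Lt, h ≠ cp g → ∃ p : Fin 3 → Bool, p g.1 = g.2 ∧ p h.1 = h.2 := by
  intro g h hne
  refine ⟨Function.update (fun _ => h.2) g.1 g.2, by simp, ?_⟩
  by_cases e : h = g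
  · subst e; simp
  · simp [fst_ne e hne]

def RH (ι : Type) [Fintype ι] [DecidableEq ι] (n : ℕ) : Prop :=
  ∀ (X : Finset (ι → Lt)) (U : Multiset (ι → Lt)), Code X → TF X → X.card < n →
    (∀ z, cnt U z = cnt X.val z) → U = X.val

theorem RH.f {n : ℕ} (h : RH ι n) {X : Finset (ι → Lt)} (hX : Code X) (hT : TF X)
    (p : (ι → Lt) → Prop) [DecidablePred p] (hc : (X.filter p).card < n)
    {U : Multiset (ι → Lt)} (hU : ∀ z, cnt U z = cnt (X.val.filter p) z) :
    U = X.val.filter p :=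
  h (X.filter p) U (hX.mono (Finset.filter_subset _ _)) (hT.mono (Finset.filter_subset _ _)) hc hU

theorem G4 {n : ℕ} (h : RH ι n) {X : Finset (ι → Lt)} (hX : Code X) (hT : TF X)
    {U : Multiset (ι → Lt)} (hU : ∀ z, cnt U z = cnt X.val z) {i : ι} {p : Fin 3 → Bool} {g : Lt}
    (hg : p g.1 = g.2) (hp : ∀ x ∈ X, p (x i).1 = (x i).2 → x i = g)
    (hc : (X.filter (fun w => w i = g)).card < n) {u : ι → Lt} (hu : u ∈ U)
    (hpu : p (u i).1 = (u i).2) : Function.update u i g ∈ X := by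
  have e : X.val.filter (fun w => w i = g) = Sl X.val i p g := Sl_eq hg hp
  have : Sl U i p g = X.val.filter (fun w => w i = g) := by
    apply h.f hX hT _ hc
    intro z
    rw [e]; exact cnt_Sl i p g hU z
  have hm : Function.update u i g ∈ Sl U i p g := by
    unfold Sl
    exact Multiset.mem_map_of_mem _ (Multiset.mem_filter.2 ⟨hu, hpu⟩)
  rw [this] at hm
  exact (Multiset.mem_filter.1 hm).1

theorem G5 {n : ℕ} (h : RH ι n) {X : Finset (ι → Lt)} (hX : Code X) (hT : TF X)
    {U : Multiset (ι → Lt)} (hU : ∀ z, cnt U z = cnt X.val z) {i : ι} {l : Lt}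
    (hl : ∀ x ∈ X, x i ≠ cp l)
    (hc : (X.filter (fun w => (w i).1 ≠ l.1)).card < n) : ∀ u ∈ U, u i ≠ cp l := by
  intro u hu hui
  have e := h.f hX hT _ hc (G1 hU hl)
  have : Function.update u i l ∈ X.val.filter (fun w => (w i).1 ≠ l.1) := by
    rw [← e, Multiset.mem_add]
    exact Or.inr (Multiset.mem_map_of_mem _ (Multiset.mem_filter.2 ⟨hu, hui⟩))
  have := (Multiset.mem_filter.1 this).2
  simp at this

structure Bad (X : Finset (ι → Lt)) (U : Multiset (ι → Lt)) : Prop where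
  code : Code X
  tf : TF X
  card : X.card ≤ 9
  cnt : ∀ z, cnt U z = PB.cnt X.val z
  disj : ∀ u ∈ U, u ∉ X
  ih : RH ι X.card
  ne : X.Nonempty

variable {X : Finset (ι → Lt)} {U : Multiset (ι → Lt)}

theorem Bad.cov (B : Bad X U) {u} (hu : u ∈ U) : Cov X u := by
  intro z hz
  have := cnt_pos.2 ⟨u, hu, hz⟩
  rw [B.cnt] at this
  exact cnt_pos.1 this

theorem Bad.cov' (B : Bad X U) {x z} (hx : x ∈ X) (hz : M x z) : ∃ u ∈ U, M u z := by
  have := cnt_pos (X := X.val).2 ⟨x, hx, hz⟩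
  rw [← B.cnt] at this
  exact cnt_pos.1 this

theorem Bad.exu (B : Bad X U) : ∃ u, u ∈ U := by
  obtain ⟨x, hx⟩ := B.ne
  obtain ⟨z, hz⟩ := exM x
  obtain ⟨u, hu, _⟩ := B.cov' hx hz
  exact ⟨u, hu⟩

theorem Bad.F1a (B : Bad X U) {i : ι} {x y : ι → Lt} (hx : x ∈ X) (hy : y ∈ X)
    (hne : y i ≠ x i) : ∃ t ∈ X, t i = cp (x i) := by
  by_contra hno
  have hl : ∀ t ∈ X, t i ≠ cp (x i) := fun t ht e => hno ⟨t, ht, e⟩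
  have hl' := G5 B.ih B.code B.tf B.cnt hl (Finset.card_lt_card
    (Finset.filter_ssubset.2 ⟨x, hx, by simp⟩))
  have e := B.ih.f B.code B.tf _ (Finset.card_lt_card
    (Finset.filter_ssubset.2 ⟨y, hy, hne⟩)) (G2 B.cnt hl hl')
  have hx' : x ∈ X.val.filter (fun w => w i = x i) := Multiset.mem_filter.2 ⟨hx, rfl⟩
  rw [← e] at hx'
  exact B.disj x (Multiset.mem_filter.1 hx').1 hx

theorem Bad.F1b (B : Bad X U) {i : ι} {x y : ι → Lt} (hx : x ∈ X) (hy : y ∈ X)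
    (hne : y i ≠ x i) : ∃ t ∈ X, (t i).1 ≠ (x i).1 := by
  by_contra hno
  have hl : ∀ t ∈ X, (t i).1 = (x i).1 := by
    intro t ht; by_contra h; exact hno ⟨t, ht, h⟩
  obtain ⟨u, hu⟩ := B.exu
  have hyx : y i = cp (x i) := (eq_or_cp (hl y hy)).resolve_left hne
  have key : ∀ g : Lt, g.1 = (x i).1 → u i ≠ cp g → Function.update u i g ∈ X := by
    intro g hg hug
    obtain ⟨p, hp1, hp2⟩ := exP g (u i) hug
    refine G4 B.ih B.code B.tf B.cnt hp1 ?_ ?_ hu hp2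
    · intro t ht hpt
      rcases eq_or_cp ((hl t ht).trans hg.symm) with h | h
      · exact h
      · rw [h, cp_fst, hp1] at hpt; simp at hpt
    · apply Finset.card_lt_card
      rw [Finset.filter_ssubset]
      by_cases h : x i = g
      · exact ⟨y, hy, by rw [hyx, h]; exact cp_ne g⟩
      · exact ⟨x, hx, h⟩
  by_cases h1 : (u i).1 = (x i).1
  · have := key (u i) h1 (ne_cp _)
    rw [Function.update_eq_self] at this
    exact B.disj u hu this
  · have k1 := key (x i) rfl (fun e => h1 (by rw [e]; rfl))
    have k2 := key (cp (x i)) rfl (fun e => h1 (by rw [e]; rfl))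
    apply B.tf _ k1 i
    simpa using k2

theorem Bad.F2 (B : Bad X U) {i : ι} {x y : ι → Lt} (hx : x ∈ X) (hy : y ∈ X)
    (hne : y i ≠ x i) : ∃ u ∈ U, u i = x i := by
  by_contra hno
  have hl : ∀ t ∈ U, t i ≠ x i := fun t ht e => hno ⟨t, ht, e⟩
  have e := B.ih.f B.code B.tf _ (Finset.card_lt_card
    (Finset.filter_ssubset.2 ⟨x, hx, ne_cp _⟩)) (G3 B.cnt hl)
  have : Function.update x i (cp (x i)) ∈ X.val.filter (fun w => w i = cp (x i)) := by
    rw [← e, Multiset.mem_add]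
    exact Or.inr (Multiset.mem_map_of_mem (fun w => Function.update w i (cp (x i)))
      (Multiset.mem_filter (p := fun w => w i = x i).2 ⟨hx, rfl⟩))
  exact B.tf x hx i (Multiset.mem_filter.1 this).1

/-- number of words with letter l at i -/
def nc (X : Finset (ι → Lt)) (i : ι) (l : Lt) : ℕ := (X.filter (fun w => w i = l)).card

theorem nc_pos {i : ι} {l : Lt} : 0 < nc X i l ↔ ∃ x ∈ X, x i = l := by
  unfold nc; rw [Finset.card_pos]; simp [Finset.Nonempty]

theorem nc_two {i : ι} {l : Lt} {x y : ι → Lt} (hx : x ∈ X) (hy : y ∈ X) (hne : y ≠ x)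
    (hxi : x i = l) (hyi : y i = l) : 2 ≤ nc X i l := by
  unfold nc
  have : 1 < (X.filter (fun w => w i = l)).card :=
    Finset.one_lt_card.2 ⟨x, Finset.mem_filter.2 ⟨hx, hxi⟩, y, Finset.mem_filter.2 ⟨hy, hyi⟩, hne.symm⟩
  exact this

theorem nc_sum (X : Finset (ι → Lt)) (i : ι) : ∑ l, nc X i l = X.card := by
  unfold nc
  exact (Finset.card_eq_sum_card_fiberwise (f := fun w : ι → Lt => w i) (t := Finset.univ)
    (fun _ _ => by simp)).symm

theorem third : ∀ a b : Lt, ∃ t : Lt, t.1 ≠ a.1 ∧ t.1 ≠ b.1 := by decide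
theorem six : ∀ a b t : Lt, a.1 ≠ b.1 → t.1 ≠ a.1 → t.1 ≠ b.1 → ∀ m : Lt,
    m = a ∨ m = cp a ∨ m = b ∨ m = cp b ∨ m = t ∨ m = cp t := by decide
theorem six_sum (c : Lt → ℕ) (a b t : Lt) (h1 : a.1 ≠ b.1) (h2 : t.1 ≠ a.1) (h3 : t.1 ≠ b.1) :
    ∑ l, c l = c a + c (cp a) + c b + c (cp b) + c t + c (cp t) := by
  have : (Finset.univ : Finset Lt) = {a, cp a, b, cp b, t, cp t} := by
    ext m; simpa using six a b t h1 h2 h3 m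
  rw [this]
  have n : ∀ {x y : Lt}, x.1 ≠ y.1 → x ≠ y := fun h e => h (by rw [e])
  rw [Finset.sum_insert, Finset.sum_insert, Finset.sum_insert, Finset.sum_insert,
    Finset.sum_insert, Finset.sum_singleton]
  · ring
  · simpa using ne_cp t
  · simp only [Finset.mem_insert, Finset.mem_singleton, not_or]
    exact ⟨n h3.symm, n h3.symm⟩
  · simp only [Finset.mem_insert, Finset.mem_singleton, not_or]
    exact ⟨ne_cp b, n h3.symm, n h3.symm⟩
  · simp only [Finset.mem_insert, Finset.mem_singleton, not_or]
    exact ⟨n h1, n h1, n h2.symm, n h2.symm⟩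
  · simp only [Finset.mem_insert, Finset.mem_singleton, not_or]
    exact ⟨ne_cp a, n h1, n h1, n h2.symm, n h2.symm⟩

def Qp (c : Lt → ℕ) (a : Lt) : Prop := (2 ≤ c a ∧ 2 ≤ c (cp a)) ∨ 5 ≤ c a ∨ 5 ≤ c (cp a)
theorem Qp_cp {c : Lt → ℕ} {a : Lt} (h : Qp c (cp a)) : Qp c a := by
  unfold Qp at *; rw [cp_cp] at h; omega

theorem Qsel (c : Lt → ℕ) (a b t m : Lt) (h1 : a.1 ≠ b.1) (h2 : t.1 ≠ a.1) (h3 : t.1 ≠ b.1)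
    (hm : m.1 ≠ a.1) (hQ : Qp c m) : Qp c b ∨ Qp c t := by
  rcases six a b t h1 h2 h3 m with h | h | h | h | h | h <;> subst h
  · exact absurd rfl hm
  · exact absurd rfl hm
  · exact Or.inl hQ
  · exact Or.inl (Qp_cp hQ)
  · exact Or.inr hQ
  · exact Or.inr (Qp_cp hQ)

theorem arith (c : Lt → ℕ) (hs : ∑ l, c l ≤ 9) (hp : ∀ l, 0 < c l → 0 < c (cp l))
    (hQ : ∀ b, 0 < c b → c b ≤ 4 → ∃ a, a.1 ≠ b.1 ∧ Qp c a)
    (l m : Lt) (hlm : l.1 ≠ m.1) (hl : 0 < c l) (hm : 0 < c m) :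
    ∃ a b : Lt, a.1 ≠ b.1 ∧ c a = 2 ∧ c (cp a) = 2 ∧ c b ≤ 3 ∧ c (cp b) ≤ 3 ∧ 0 < c b ∧
      ∀ x, 0 < c x → x.1 = a.1 ∨ x.1 = b.1 := by
  obtain ⟨t, ht1, ht2⟩ := third l m
  rw [six_sum c l m t hlm ht1 ht2] at hs
  have hl' := hp l hl
  have hm' := hp m hm
  have q1 : c l ≤ 4 → Qp c m ∨ Qp c t := fun h => by
    obtain ⟨a, h1, h2⟩ := hQ l hl h
    exact Qsel c l m t a hlm ht1 ht2 h1 h2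
  have q2 : c (cp l) ≤ 4 → Qp c m ∨ Qp c t := fun h => by
    obtain ⟨a, h1, h2⟩ := hQ (cp l) hl' h
    exact Qsel c l m t a hlm ht1 ht2 h1 h2
  have q3 : c m ≤ 4 → Qp c l ∨ Qp c t := fun h => by
    obtain ⟨a, h1, h2⟩ := hQ m hm h
    exact Qsel c m l t a hlm.symm ht2 ht1 h1 h2
  have q4 : c (cp m) ≤ 4 → Qp c l ∨ Qp c t := fun h => by
    obtain ⟨a, h1, h2⟩ := hQ (cp m) hm' h
    exact Qsel c m l t a hlm.symm ht2 ht1 h1 h2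
  have q5 : 0 < c t → c t ≤ 4 → Qp c l ∨ Qp c m := fun h0 h => by
    obtain ⟨a, h1, h2⟩ := hQ t h0 h
    exact Qsel c t l m a ht1 ht2.symm hlm.symm h1 h2
  have p1 := hp t
  have p2 := hp (cp t)
  rw [cp_cp] at p2
  unfold Qp at *
  have z1 : c t = 0 := by omega
  have z2 : c (cp t) = 0 := by omega
  have z3 : 2 ≤ c l ∧ 2 ≤ c (cp l) ∧ 2 ≤ c m ∧ 2 ≤ c (cp m) := by omega
  have hx : ∀ x, 0 < c x → x.1 = l.1 ∨ x.1 = m.1 := by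
    intro x hx
    rcases six l m t hlm ht1 ht2 x with h | h | h | h | h | h <;> subst h
    · exact Or.inl rfl
    · exact Or.inl rfl
    · exact Or.inr rfl
    · exact Or.inr rfl
    · omega
    · omega
  by_cases hh : c l = 2 ∧ c (cp l) = 2
  · exact ⟨l, m, hlm, hh.1, hh.2, by omega, by omega, hm, hx⟩
  · exact ⟨m, l, hlm.symm, by omega, by omega, by omega, by omega, hl, fun x h => (hx x h).symm⟩

theorem Bad.sizes (B : Bad X U) {i : ι} {x y : ι → Lt} (hx : x ∈ X) (hy : y ∈ X)
    (hne : y i ≠ x i) : ∃ a b : Lt, a.1 ≠ b.1 ∧ nc X i a = 2 ∧ nc X i (cp a) = 2 ∧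
      nc X i b ≤ 3 ∧ nc X i (cp b) ≤ 3 ∧ 0 < nc X i b ∧
      ∀ x ∈ X, (x i).1 = a.1 ∨ (x i).1 = b.1 := by
  have nf : ∀ t ∈ X, ∃ s ∈ X, s i ≠ t i := by
    intro t ht
    by_cases h : x i = t i
    · exact ⟨y, hy, by rw [← h]; exact hne⟩
    · exact ⟨x, hx, h⟩
  obtain ⟨m, hm, hmx⟩ := B.F1b hx hy hne
  obtain ⟨a, b, h1, h2, h3, h4, h5, h6, h7⟩ := arith (nc X i) (by rw [nc_sum]; exact B.card)
    (by
      intro l hl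
      obtain ⟨t, ht, rfl⟩ := nc_pos.1 hl
      obtain ⟨s, hs, hst⟩ := nf t ht
      exact nc_pos.2 (B.F1a ht hs hst))
    (by
      intro b hb hb4
      obtain ⟨t, ht, rfl⟩ := nc_pos.1 hb
      obtain ⟨s, hs, hst⟩ := nf t ht
      obtain ⟨u, hu, hui⟩ := B.F2 ht hs hst
      have hc := B.cov hu
      obtain ⟨v, hv, hvu, hvm⟩ := PP (i := i) B.code B.tf hc (B.disj u hu) (by rw [hui]; exact hb4)
      obtain ⟨w, hw, hwi, hwm⟩ := N0 B.code hc hv rfl hvu hvm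
      refine ⟨v i, by rw [← hui]; exact hvu, ?_⟩
      by_cases c1 : 5 ≤ nc X i (v i)
      · exact Or.inr (Or.inl c1)
      by_cases c2 : 5 ≤ nc X i (cp (v i))
      · exact Or.inr (Or.inr c2)
      left
      obtain ⟨r, hr, hrv, hri, _⟩ := N2 B.code B.tf hc hv rfl hvu hvm
        (by unfold nc at c2; omega)
      obtain ⟨r', hr', hrv', hri', _⟩ := N2 B.code B.tf hc hw hwi hvu hwm
        (by rw [cp_cp]; unfold nc at c1; omega)
      exact ⟨nc_two hv hr hrv rfl hri, nc_two hw hr' hrv' hwi hri'⟩)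
    (m i) (x i) hmx (nc_pos.2 ⟨m, hm, rfl⟩) (nc_pos.2 ⟨x, hx, rfl⟩)
  exact ⟨a, b, h1, h2, h3, h4, h5, h6, fun x hx => h7 _ (nc_pos.2 ⟨x, hx, rfl⟩)⟩

end PB

namespace PB
variable {ι : Type} [Fintype ι] [DecidableEq ι]
variable {X : Finset (ι → Lt)} {U : Multiset (ι → Lt)}

theorem F_comm (z : ι → Fin 3 → Bool) {i j : ι} (h : i ≠ j) (a b : Lt) :
    F (F z i a) j b = F (F z j b) i a := by
  funext t
  by_cases h1 : t = i
  · subst h1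
    rw [F_ne _ _ h]
    simp [F, h]
  · by_cases h2 : t = j
    · subst h2
      rw [F_ne _ _ h1]
      simp [F, h1]
    · rw [F_ne _ _ h1, F_ne _ _ h2, F_ne _ _ h2, F_ne _ _ h1]

theorem M_self {x : ι → Lt} {z} {i : ι} {a : Lt} (hm : M x z) (hx : x i = a) : F z i a = z :=
  F_eq _ _ _ (by have := hm i; rwa [hx] at this)

theorem RR {u x : ι → Lt} {i : ι} {a : Lt} (hX : Code X) (hc : Cov X u)
    (hx : x ∈ X) (hxi : x i = a) (ha : a.1 ≠ (u i).1) {z} (hu : M u z) (hm : M x (F z i a)) :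
    ∃ y ∈ X, y i = cp a ∧ M y (F z i (cp a)) := by
  have hu' : M u (F z i (cp a)) := (M_F_other (by exact ha.symm)).2 hu
  obtain ⟨y, hy, hyz⟩ := hc _ hu'
  refine ⟨y, hy, ?_, hyz⟩
  by_contra h
  have h1 : y i ≠ a := by have := M_F_ne hyz; rwa [cp_cp] at this
  have h2 : (y i).1 ≠ a.1 := fst_ne h1 h
  have h3 : M y (F z i a) := (M_F_other h2).2 ((M_F_other (l := cp a) (by exact h2)).1 hyz)
  have := hX y hy x hx _ h3 hm
  rw [this] at h1; exact h1 hxi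

theorem two {i : ι} {l : Lt} (h : nc X i l = 2) {x y t : ι → Lt} (hx : x ∈ X) (hy : y ∈ X)
    (hne : y ≠ x) (hxi : x i = l) (hyi : y i = l) (ht : t ∈ X) (hti : t i = l) :
    t = x ∨ t = y := by
  by_contra hno
  push Not at hno
  have : 2 < (X.filter (fun w => w i = l)).card :=
    Finset.two_lt_card.2 ⟨x, Finset.mem_filter.2 ⟨hx, hxi⟩, y, Finset.mem_filter.2 ⟨hy, hyi⟩,
      t, Finset.mem_filter.2 ⟨ht, hti⟩, hne.symm, hno.1.symm, hno.2.symm⟩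
  unfold nc at h; omega

theorem claim {u x1 x2 : ι → Lt} {i j : ι} {a : Lt} (hX : Code X) (hT : TF X) (hc : Cov X u)
    (ha : a.1 ≠ (u i).1) (hij : i ≠ j) (h2 : nc X i (cp a) = 2)
    (hx1 : x1 ∈ X) (hx2 : x2 ∈ X) (hx1i : x1 i = a) (hx2i : x2 i = a)
    (hA : ∀ t ∈ X, t i = a → t = x1 ∨ t = x2) (hj : x2 j = cp (x1 j))
    (hm : ∀ t ∈ X, (t i).1 = a.1 → Mt t u) : ∃ y ∈ X, y i = cp a ∧ y j = u j := by
  by_contra hno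
  have hapair : ∀ t ∈ X, t i = a → (t j).1 = (x1 j).1 := by
    intro t ht hta
    rcases hA t ht hta with h | h
    · rw [h]
    · rw [h, hj]; rfl
  have hm' : ∀ t ∈ X, t i = cp a → Mt t u := fun t ht h => hm t ht (by rw [h]; rfl)
  have hu1 : (x1 j).1 ≠ (u j).1 := by
    refine fst_ne ?_ (Mt_ne (hm x1 hx1 (by rw [hx1i])) j)
    intro e
    have := Mt_ne (hm x2 hx2 (by rw [hx2i])) j
    rw [hj, e] at this; exact this rfl
  have RRb : ∀ {y z}, y ∈ X → y i = cp a → M u z → M y (F z i (cp a)) →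
      ∃ x ∈ X, x i = a ∧ M x (F z i a) := by
    intro y z hy hyi hu hm
    have := RR hX hc hy hyi (by exact ha) hu hm
    rwa [cp_cp] at this
  -- step 1
  have S1 : ∀ y ∈ X, y i = cp a → (y j).1 = (x1 j).1 := by
    intro y hy hyi
    by_contra hg
    have hyu := hm' y hy hyi
    have hg2 : (y j).1 ≠ (u j).1 := fst_ne (fun e => hno ⟨y, hy, hyi, e⟩) (Mt_ne hyu j)
    have hinv : ∀ z, M u z → (∃ x ∈ X.filter (fun x => x i = cp a), M x z) →
        ∀ h : Lt, h.1 = (y j).1 → ∃ x ∈ X.filter (fun x => x i = cp a), M x (F z j h) := by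
      rintro z hz ⟨t, ht, htz⟩ h hh
      obtain ⟨htX, hti⟩ := Finset.mem_filter.1 ht
      have e1 : F z i (cp a) = z := M_self htz hti
      obtain ⟨x, hx, hxi, hxz⟩ := RRb htX hti hz (by rw [e1]; exact htz)
      have hxz' : M x (F (F z j h) i a) := by
        rw [← F_comm _ hij]
        refine (M_F_other ?_).2 hxz
        rw [hh, hapair x hx hxi]; exact fun e => hg e.symm
      have huz : M u (F z j h) := (M_F_other (by rw [hh]; exact hg2.symm)).2 hz
      obtain ⟨s, hs, hsi, hsz⟩ := RR hX hc hx hxi ha huz hxz'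
      rw [← F_comm _ hij, e1] at hsz
      exact ⟨s, Finset.mem_filter.2 ⟨hs, hsi⟩, hsz⟩
    have huniq : ∀ x ∈ X.filter (fun x => x i = cp a), x j = y j → Mt x u → x = y := by
      intro x hx hxj _
      by_contra hne
      obtain ⟨hxX, hxi⟩ := Finset.mem_filter.1 hx
      obtain ⟨z, hz1, hz2⟩ := hyu
      obtain ⟨t, ht, htz⟩ := hinv z hz2 ⟨y, Finset.mem_filter.2 ⟨hy, hyi⟩, hz1⟩ (cp (y j)) rfl
      obtain ⟨htX, hti⟩ := Finset.mem_filter.1 ht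
      have := M_F_ne htz
      rw [cp_cp] at this
      rcases two h2 hy hxX hne hyi hxi htX hti with e | e
      · rw [e] at this; exact this rfl
      · rw [e] at this; exact this hxj
    have hYc := hX.mono (Finset.filter_subset (fun x => x i = cp a) X)
    have hYt := hT.mono (Finset.filter_subset (fun x => x i = cp a) X)
    have hyY : y ∈ X.filter (fun x => x i = cp a) := Finset.mem_filter.2 ⟨hy, hyi⟩
    have W := Wcov hYc hg2 hinv hyY rfl hyu huniq
    refine filt hYt rfl hyY (L5 _ _ _ rfl ?_ (hYc.mono (Finset.filter_subset _ _))
      (hYt.mono (Finset.filter_subset _ _)) W)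
    refine le_trans (Finset.card_le_card (Finset.filter_subset _ _)) ?_
    unfold nc at h2; omega
  -- step 2
  have S2 : ∀ x ∈ X, x i = a → ∃ y ∈ X, y i = cp a ∧ y j = x j := by
    intro x hx hxi
    obtain ⟨z, hz1, hz2⟩ := hm x hx (by rw [hxi])
    obtain ⟨y, hy, hyi, hyz⟩ := RR hX hc hx hxi ha hz2 (by rw [M_self hz1 hxi]; exact hz1)
    refine ⟨y, hy, hyi, ?_⟩
    rcases eq_or_cp ((S1 y hy hyi).trans (hapair x hx hxi).symm) with h | h
    · exact h
    · refine absurd h (M_ne hyz ?_)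
      rw [F_ne _ _ hij.symm]; exact hz1 j
  obtain ⟨y1, hy1, hy1i, hy1j⟩ := S2 x1 hx1 hx1i
  obtain ⟨y2, hy2, hy2i, hy2j⟩ := S2 x2 hx2 hx2i
  have hy12 : y2 ≠ y1 := by
    intro e; rw [e, hy1j, hj] at hy2j; exact ne_cp _ hy2j
  have hYs : ({x1, y1} : Finset (ι → Lt)) ⊆ X := by
    intro t ht
    simp only [Finset.mem_insert, Finset.mem_singleton] at ht
    rcases ht with h | h <;> rw [h] <;> assumption
  have hne : x1 ≠ y1 := by
    intro e; rw [e, hy1i] at hx1i; exact cp_ne _ hx1i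
  have hinv : ∀ z, M u z → (∃ x ∈ ({x1, y1} : Finset (ι → Lt)), M x z) →
        ∀ h : Lt, h.1 = a.1 → ∃ x ∈ ({x1, y1} : Finset (ι → Lt)), M x (F z i h) := by
    rintro z hz ⟨t, ht, htz⟩ h hh
    simp only [Finset.mem_insert, Finset.mem_singleton] at ht
    rcases ht with ht | ht <;> subst ht
    · rcases eq_or_cp hh with e | e <;> subst e
      · exact ⟨t, by simp, by rw [M_self htz hx1i]; exact htz⟩
      · obtain ⟨s, hs, hsi, hsz⟩ := RR hX hc hx1 hx1i ha hz (by rw [M_self htz hx1i]; exact htz)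
        rcases two h2 hy1 hy2 hy12 hy1i hy2i hs hsi with e | e
        · exact ⟨y1, by simp, e ▸ hsz⟩
        · refine absurd (show s j = cp (t j) by rw [e, hy2j, hj]) (M_ne hsz ?_)
          rw [F_ne _ _ hij.symm]; exact htz j
    · rcases eq_or_cp hh with e | e <;> subst e
      · obtain ⟨s, hs, hsi, hsz⟩ := RRb hy1 hy1i hz (by rw [M_self htz hy1i]; exact htz)
        rcases hA s hs hsi with e | e
        · exact ⟨x1, by simp, e ▸ hsz⟩
        · refine absurd (show s j = cp (t j) by rw [e, hy1j, hj]) (M_ne hsz ?_)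
          rw [F_ne _ _ hij.symm]; exact htz j
      · exact ⟨t, by simp, by rw [M_self htz hy1i]; exact htz⟩
  have hYc := hX.mono hYs
  have hYt := hT.mono hYs
  have W := Wcov hYc ha hinv (w := x1) (by simp) hx1i (hm x1 hx1 (by rw [hx1i])) (by
    intro x hx hxa _
    simp only [Finset.mem_insert, Finset.mem_singleton] at hx
    rcases hx with h | h
    · exact h
    · rw [h, hy1i] at hxa; exact absurd hxa (cp_ne a))
  refine filt hYt hx1i (by simp) (L5 _ _ _ rfl ?_ (hYc.mono (Finset.filter_subset _ _))
      (hYt.mono (Finset.filter_subset _ _)) W)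
  refine le_trans (Finset.card_le_card (Finset.filter_subset _ _)) ?_
  refine le_trans (Finset.card_insert_le _ _) ?_
  simp

theorem Bad.false (B : Bad X U) : False := by
  obtain ⟨u00, hu00⟩ := B.exu
  have hX := B.code
  have hT := B.tf
  have hcard : 1 < X.card := by
    by_contra h
    exact B.disj _ hu00 (L5 _ _ _ rfl (by omega) hX hT (B.cov hu00))
  obtain ⟨x, hx, y, hy, hxy⟩ := Finset.one_lt_card.1 hcard
  obtain ⟨i, hi⟩ := Function.ne_iff.1 hxy.symm
  obtain ⟨a, b, hab, ca, ca', cb, cb', hb0, hpairs⟩ := B.sizes hx hy hi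
  have meetA : ∀ u ∈ U, (u i).1 = b.1 → ∀ t ∈ X, (t i).1 = a.1 → Mt t u := by
    intro u hu hui
    have hc := B.cov hu
    have hui3 : nc X i (u i) ≤ 3 := by
      rcases eq_or_cp hui with h | h <;> rw [h] <;> assumption
    obtain ⟨v, hv, hvu, hvm⟩ := PP (i := i) hX hT hc (B.disj u hu) (by unfold nc at hui3; omega)
    have hva : (v i).1 = a.1 := (hpairs v hv).resolve_right (fun e => hvu (e.trans hui.symm))
    have two' : ∀ l : Lt, l.1 = a.1 → nc X i l = 2 := by
      intro l hl
      rcases eq_or_cp hl with h | h <;> rw [h] <;> assumption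
    have key : ∀ v ∈ X, (v i).1 = a.1 → Mt v u → ∀ t ∈ X, t i = v i → Mt t u := by
      intro v hv hva hvm t ht hti
      have h2 := two' (v i) hva
      have h2' := two' (cp (v i)) hva
      obtain ⟨r, hr, hrv, hri, hrm⟩ := N2 hX hT hc hv rfl
        (by rw [hva, hui]; exact hab) hvm (by unfold nc at h2'; omega)
      rcases two h2 hv hr hrv rfl hri ht hti with e | e <;> rw [e] <;> assumption
    obtain ⟨w, hw, hwi, hwm⟩ := N0 hX hc hv rfl hvu hvm
    intro t ht hta
    rcases eq_or_cp (hta.trans hva.symm) with h | h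
    · exact key v hv hva hvm t ht h
    · exact key w hw (by rw [hwi]; exact hva) hwm t ht (h.trans hwi.symm)
  obtain ⟨x1, x2, hx12, hAeq⟩ := Finset.card_eq_two.1 (show (X.filter (fun w => w i = a)).card = 2 from ca)
  have hm1 : x1 ∈ X ∧ x1 i = a := by
    rw [← Finset.mem_filter (p := fun w : ι → Lt => w i = a), hAeq]; simp
  have hm2 : x2 ∈ X ∧ x2 i = a := by
    rw [← Finset.mem_filter (p := fun w : ι → Lt => w i = a), hAeq]; simp
  have hA : ∀ t ∈ X, t i = a → t = x1 ∨ t = x2 := by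
    intro t ht hta
    have : t ∈ X.filter (fun w => w i = a) := Finset.mem_filter.2 ⟨ht, hta⟩
    rw [hAeq] at this
    simpa using this
  have hj : ∃ j, x2 j = cp (x1 j) := by
    by_contra h
    push Not at h
    obtain ⟨z, h1, h2⟩ := Mt_of h
    exact hx12 (hX x1 hm1.1 x2 hm2.1 z h2 h1)
  obtain ⟨j, hj⟩ := hj
  have hij : i ≠ j := by
    rintro rfl
    rw [hm1.2, hm2.2] at hj; exact ne_cp a hj
  have Cl : ∀ u ∈ U, (u i).1 = b.1 → ∃ y ∈ X, y i = cp a ∧ y j = u j := by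
    intro u hu hui
    exact claim hX hT (B.cov hu) (by rw [hui]; exact hab) hij ca' hm1.1 hm2.1 hm1.2 hm2.2 hA hj
      (meetA u hu hui)
  have hue : ∀ u ∈ U, (u i).1 = b.1 → (u j).1 ≠ (x1 j).1 := by
    intro u hu hui
    refine Ne.symm (fst_ne ?_ (Mt_ne (meetA u hu hui x1 hm1.1 (by rw [hm1.2])) j))
    intro e
    have := Mt_ne (meetA u hu hui x2 hm2.1 (by rw [hm2.2])) j
    rw [hj, e] at this; exact this rfl
  obtain ⟨xb, hxb, hxbi⟩ := nc_pos.1 hb0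
  have hxbx1 : x1 i ≠ xb i := by
    rw [hm1.2, hxbi]; intro e; exact hab (by rw [e])
  obtain ⟨u0, hu0, hu0i⟩ := B.F2 hxb hm1.1 hxbx1
  have hu0b : (u0 i).1 = b.1 := by rw [hu0i, hxbi]
  obtain ⟨x', hx', hx'i, hx'j⟩ := Cl u0 hu0 hu0b
  have hqe := hue u0 hu0 hu0b
  have hnf : x2 j ≠ x1 j := by rw [hj]; exact cp_ne _
  obtain ⟨p1, p2, hp12, -, -, -, -, -, hpj⟩ := B.sizes hm1.1 hm2.1 hnf
  have hpj' : ∀ t ∈ X, (t j).1 = (x1 j).1 ∨ (t j).1 = (u0 j).1 := by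
    intro t ht
    have h1 := hpj t ht
    have h2 := hpj x1 hm1.1
    have h3 := hpj x' hx'
    rw [hx'j] at h3
    rcases h1 with h1 | h1 <;> rcases h2 with h2 | h2 <;> rcases h3 with h3 | h3 <;>
      simp_all
  have hq : ∀ u ∈ U, (u i).1 = b.1 → u j = u0 j := by
    intro u hu hui
    obtain ⟨w, hw, _, hwj⟩ := Cl u hu hui
    have h1 : (u j).1 = (u0 j).1 := by
      have := hpj' w hw
      rw [hwj] at this
      exact this.resolve_left (hue u hu hui)
    rcases eq_or_cp h1 with h | h
    · exact h
    · have := Mt_ne (meetA u hu hui x' hx' (by rw [hx'i]; rfl)) j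
      rw [hx'j, h, cp_cp] at this
      exact absurd rfl this
  obtain ⟨y, hy, hyj⟩ := B.F1a (i := j) hx' hm1.1 (by
    rw [hx'j]; intro e; exact hqe (by rw [e]))
  rw [hx'j] at hyj
  have hyb : (y i).1 = b.1 := by
    refine (hpairs y hy).resolve_left (fun h => ?_)
    exact Mt_ne (meetA u0 hu0 hu0b y hy h) j hyj
  have hcov : Cov (X.filter (fun x => x i = cp (y i))) (Function.update y i (cp (y i))) := by
    intro z hz
    have hz' := M_update.1 hz
    have hyz : M y (F z i (y i)) := (M_self_F rfl).2 hz'.2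
    obtain ⟨u, hu, huz⟩ := B.cov' hy hyz
    have hui : (u i).1 ≠ (y i).1 := by
      intro e
      have h1 := hq u hu (e.trans hyb)
      have h2 := M_ne huz (hyz j)
      rw [hyj, cp_cp] at h2
      exact h2 h1
    have huz' : M u z := (M_F_other hui).1 huz
    obtain ⟨t, ht, htz⟩ := B.cov hu z huz'
    refine ⟨t, Finset.mem_filter.2 ⟨ht, ?_⟩, htz⟩
    by_contra h
    have h1 : t i ≠ y i := by
      have := M_ne htz hz'.1; rwa [cp_cp] at this
    have h2 : (t i).1 ≠ (y i).1 := fst_ne h1 h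
    have := hX t ht y hy _ ((M_F_other h2).2 htz) hyz
    rw [this] at h1; exact h1 rfl
  have h3 : nc X i (cp (y i)) ≤ 3 := by
    rcases eq_or_cp hyb with h | h <;> rw [h]
    · assumption
    · rw [cp_cp]; assumption
  exact filt hT rfl hy (L5 _ _ _ rfl (by unfold nc at h3; omega)
    (hX.mono (Finset.filter_subset _ _)) (hT.mono (Finset.filter_subset _ _)) hcov)

theorem R9 : ∀ n : ℕ, n ≤ 10 → RH ι n := by
  intro n
  induction n with
  | zero => intro _ X U _ _ h; omega
  | succ n ih =>
    intro hn X U hX hT hc hU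
    have ih' := ih (by omega)
    rcases Nat.lt_or_ge X.card n with h | h
    · exact ih' X U hX hT h hU
    have hcn : X.card = n := by omega
    by_cases hd : ∃ u ∈ U, u ∈ X
    · obtain ⟨u, hu, hux⟩ := hd
      have e1 := Multiset.cons_erase hu
      have e2 : u ::ₘ (X.erase u).val = X.val := by
        rw [Finset.erase_val]; exact Multiset.cons_erase hux
      have := ih' (X.erase u) (U.erase u) (hX.mono (Finset.erase_subset _ _))
        (hT.mono (Finset.erase_subset _ _)) (by rw [← hcn]; exact Finset.card_erase_lt_of_mem hux)
        (by
          intro z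
          have := hU z
          rw [← e1, ← e2, ← Multiset.singleton_add, ← Multiset.singleton_add, cnt_add, cnt_add] at this
          omega)
      rw [← e1, ← e2, this]
    · push Not at hd
      rcases X.eq_empty_or_nonempty with he | he
      · have := card_eq hU
        subst he
        simpa using this
      · exact (Bad.false ⟨hX, hT, by omega, hU, hd, by rw [hcn]; exact ih', he⟩).elim

end PB

namespace PB
variable {ι : Type} [Fintype ι] [DecidableEq ι]

theorem part (X : Finset (ι → Lt)) (i : ι) (l : Lt) :
    (X.filter (fun w => w i = l)).card + (X.filter (fun w => w i = cp l)).card +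
      (X.filter (fun w => (w i).1 ≠ l.1)).card = X.card := by
  rw [Finset.card_filter, Finset.card_filter, Finset.card_filter, ← Finset.sum_add_distrib,
    ← Finset.sum_add_distrib, Finset.card_eq_sum_ones]
  apply Finset.sum_congr rfl
  intro x _
  by_cases h1 : x i = l
  · simp [h1, ne_cp]
  · by_cases h2 : x i = cp l
    · simp [h2, cp_ne]
    · simp [h1, h2, fst_ne h1 h2]

theorem main' {V W : Finset (ι → Lt)} (hV : Code V) (hW : Code W) (tV : TF V) (tW : TF W)
    (hd : ∀ v ∈ V, v ∉ W) (h : ∀ z, cnt W.val z = cnt V.val z) (hc : V.card ≤ 16)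
    {i : ι} {l : Lt} (hl : ∀ v ∈ V, v i ≠ cp l) (h1 : ∃ v ∈ V, v i = l) (h2 : ∃ v ∈ V, v i ≠ l) :
    False := by
  have R : RH ι 10 := R9 10 le_rfl
  obtain ⟨v1, hv1, hv1i⟩ := h1
  obtain ⟨v2, hv2, hv2i⟩ := h2
  have pV := part V i l
  have pW := part W i l
  by_cases hQ : ∀ w ∈ W, w i ≠ cp l
  · have h10 : 10 ≤ (V.filter (fun w => w i = l)).card := by
      by_contra hlt
      have e := R.f hV tV _ (by omega) (G2 h hl hQ)
      have : v1 ∈ V.val.filter (fun w => w i = l) := Multiset.mem_filter.2 ⟨hv1, hv1i⟩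
      rw [← e] at this
      exact hd v1 hv1 (Multiset.mem_filter.1 this).1
    have e := R.f hV tV _ (by omega) (G1 h hl)
    have : v2 ∈ V.val.filter (fun w => (w i).1 ≠ l.1) :=
      Multiset.mem_filter.2 ⟨hv2, fst_ne hv2i (hl v2 hv2)⟩
    rw [← e, Multiset.mem_add, Multiset.mem_add] at this
    rcases this with (h5 | h5) | h5
    · exact hd v2 hv2 (Multiset.mem_filter.1 h5).1
    · exact hd v2 hv2 (Multiset.mem_filter.1 h5).1
    · obtain ⟨w, hw, _⟩ := Multiset.mem_map.1 h5
      exact hQ w (Multiset.mem_filter.1 hw).1 (Multiset.mem_filter.1 hw).2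
  · push Not at hQ
    obtain ⟨w0, hw0, hw0i⟩ := hQ
    have hR10 : 10 ≤ (V.filter (fun w => (w i).1 ≠ l.1)).card := by
      by_contra hlt
      exact G5 R hV tV h hl (by omega) w0 hw0 hw0i
    have hW10 : 10 ≤ (W.filter (fun w => w i = l)).card := by
      by_contra hlt
      have e3 := G3 (fun z => (h z).symm) (b := cp l) hl
      rw [cp_cp] at e3
      have e := R.f hW tW _ (by omega) e3
      have : v1 ∈ W.val.filter (fun w => w i = l) := by
        rw [← e, Multiset.mem_add]
        exact Or.inl (Multiset.mem_filter.2 ⟨hv1, hv1i⟩)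
      exact hd v1 hv1 (Multiset.mem_filter.1 this).1
    have hcards : W.card = V.card := card_eq h
    have hc1 := card_eq (G1 h hl)
    rw [Multiset.card_add, Multiset.card_add, Multiset.card_map] at hc1
    change (W.filter (fun w => (w i).1 ≠ l.1)).card + (W.filter (fun w => w i = cp l)).card +
      (W.filter (fun w => w i = cp l)).card = (V.filter (fun w => (w i).1 ≠ l.1)).card at hc1
    have hr : (W.filter (fun w => (w i).1 ≠ l.1)).card ≤ 2 := by omega
    have h6 : ∀ g : Lt, g.1 ≠ l.1 → (V.filter (fun w => w i = g)).card < 10 := by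
      intro g hg
      obtain ⟨p, hp1, hp2⟩ := exP g (cp l) (fun e => hg (by rw [← cp_fst g, ← e]; rfl))
      have e := card_eq (cnt_Sl i p g h)
      unfold Sl at e
      rw [Multiset.card_map, Multiset.card_map] at e
      change (W.filter (fun w => p (w i).1 = (w i).2)).card =
        (V.filter (fun w => p (w i).1 = (w i).2)).card at e
      have a1 : (V.filter (fun w => w i = g)).card ≤
          (V.filter (fun w => p (w i).1 = (w i).2)).card := by
        apply Finset.card_le_card
        intro x hx
        obtain ⟨hx1, hx2⟩ := Finset.mem_filter.1 hx
        exact Finset.mem_filter.2 ⟨hx1, by rw [hx2]; exact hp1⟩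
      have a2 : (W.filter (fun w => p (w i).1 = (w i).2)).card ≤
          (W.filter (fun w => w i ≠ l)).card := by
        apply Finset.card_le_card
        intro x hx
        obtain ⟨hx1, hx2⟩ := Finset.mem_filter.1 hx
        refine Finset.mem_filter.2 ⟨hx1, ?_⟩
        intro e
        rw [e] at hx2
        rw [cp_fst, hx2] at hp2
        simp at hp2
      have a3 := Finset.card_filter_add_card_filter_not (s := W) (fun w => w i = l)
      simp only [ne_eq] at a2
      omega
    have hs : ∀ s : Lt, s.1 ≠ l.1 → ∃ w ∈ W, w i = s := by
      intro s hsl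
      by_contra hno
      have hno' : ∀ w ∈ W, w i ≠ s := fun w hw e => hno ⟨w, hw, e⟩
      have e := R.f hV tV _ (h6 (cp s) hsl) (G3 h hno')
      have n1 : ∀ x ∈ V, x i ≠ s := by
        intro x hx hxi
        have : Function.update x i (cp s) ∈ V.val.filter (fun w => w i = cp s) := by
          rw [← e, Multiset.mem_add]
          exact Or.inr (Multiset.mem_map_of_mem (fun w => Function.update w i (cp s))
            (Multiset.mem_filter.2 ⟨hx, hxi⟩))
        apply tV x hx i
        rw [hxi]
        exact (Multiset.mem_filter.1 this).1
      have n2 : ∀ x ∈ V, x i ≠ cp s := by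
        intro x hx hxi
        have : x ∈ V.val.filter (fun w => w i = cp s) := Multiset.mem_filter.2 ⟨hx, hxi⟩
        rw [← e, Multiset.mem_add] at this
        rcases this with h5 | h5
        · exact hd x hx (Multiset.mem_filter.1 h5).1
        · obtain ⟨w, hw, _⟩ := Multiset.mem_map.1 h5
          exact n1 w (Multiset.mem_filter.1 hw).1 (Multiset.mem_filter.1 hw).2
      obtain ⟨t, ht1, ht2⟩ := third l s
      have key : ∀ g : Lt, g.1 = t.1 → Function.update w0 i g ∈ V := by
        intro g hg
        obtain ⟨p, hp1, hp2⟩ := exP g (cp l)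
          (fun e => ht1 (by rw [← hg, ← cp_fst g, ← e]; rfl))
        refine G4 R hV tV h hp1 ?_ (h6 g (by rw [hg]; exact ht1)) hw0 (by rw [hw0i]; exact hp2)
        intro x hx hpx
        rcases six l s g (fun e => hsl e.symm) (by rw [hg]; exact ht1) (by rw [hg]; exact ht2)
          (x i) with e | e | e | e | e | e
        · rw [e] at hpx
          rw [cp_fst, hpx] at hp2
          simp at hp2
        · exact absurd e (hl x hx)
        · exact absurd e (n1 x hx)
        · exact absurd e (n2 x hx)
        · exact e
        · rw [e, cp_fst, hp1] at hpx
          simp at hpx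
      have k1 := key t rfl
      have k2 := key (cp t) rfl
      apply tV _ k1 i
      simpa using k2
    obtain ⟨s, hs1, _⟩ := third l l
    obtain ⟨t, ht1, ht2⟩ := third l s
    obtain ⟨w1, hw1, e1⟩ := hs s hs1
    obtain ⟨w2, hw2, e2⟩ := hs (cp s) hs1
    obtain ⟨w3, hw3, e3⟩ := hs t ht1
    have : 2 < (W.filter (fun w => (w i).1 ≠ l.1)).card := by
      refine Finset.two_lt_card.2 ⟨w1, Finset.mem_filter.2 ⟨hw1, by rw [e1]; exact hs1⟩,
        w2, Finset.mem_filter.2 ⟨hw2, by rw [e2]; exact hs1⟩,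
        w3, Finset.mem_filter.2 ⟨hw3, by rw [e3]; exact ht1⟩, ?_, ?_, ?_⟩
      · intro e; rw [e, e2] at e1; exact cp_ne s e1
      · intro e; rw [e, e3] at e1; exact ht2 (by rw [e1])
      · intro e; rw [e, e3] at e2; exact ht2 (by rw [e2]; rfl)
    omega

end PB

namespace PB

def ph : Fin 6 → Lt := ![(0, true), (0, false), (1, true), (1, false), (2, true), (2, false)]
theorem ph_compl : ∀ s, ph (compl6 s) = cp (ph s) := by decide
theorem ph_inj : ∀ s t, ph s = ph t → s = t := by decide
theorem compl_compl : ∀ s, compl6 (compl6 s) = s := by decide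

def Tw {d : ℕ} (v : Fin d → Fin 6) : Fin d → Lt := fun i => ph (v i)
theorem Tw_inj {d : ℕ} {u v : Fin d → Fin 6} (h : Tw u = Tw v) : u = v :=
  funext fun i => ph_inj _ _ (congrFun h i)

def pt {d : ℕ} (z : Fin d → Fin 3 → Bool) : Fin d → Set (Fin 6) :=
  fun i => {s | z i (ph s).1 = (ph s).2}

theorem M_Tw {d : ℕ} (v : Fin d → Fin 6) (z : Fin d → Fin 3 → Bool) :
    M (Tw v) z ↔ pt z ∈ WordBox compl6 v := by
  constructor
  · intro h i
    refine ⟨fun s => ?_, h i⟩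
    unfold pt
    simp only [Set.mem_setOf_eq, ph_compl, cp_fst, cp_snd]
    rcases Bool.eq_or_eq_not (z i (ph s).1) (ph s).2 with e | e
    · left; rw [e]; simp
    · right; rw [e]; simp
  · intro h i
    exact (h i).2

theorem cov_iff {d : ℕ} (V : Finset (Fin d → Fin 6)) (z : Fin d → Fin 3 → Bool) :
    (∃ x ∈ (V.image Tw).val, M x z) ↔ pt z ∈ CodeReal compl6 V := by
  unfold CodeReal
  simp only [Set.mem_iUnion, exists_prop, ← M_Tw]
  constructor
  · rintro ⟨x, hx, h⟩
    obtain ⟨v, hv, rfl⟩ := Finset.mem_image.1 (show x ∈ V.image Tw from hx)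
    exact ⟨v, hv, h⟩
  · rintro ⟨v, hv, h⟩
    exact ⟨Tw v, Finset.mem_image_of_mem Tw hv, h⟩

theorem code_Tw {d : ℕ} {V : Finset (Fin d → Fin 6)} (h : PolyboxCode compl6 V) :
    Code (V.image Tw) := by
  intro x hx y hy z h1 h2
  obtain ⟨u, hu, rfl⟩ := Finset.mem_image.1 hx
  obtain ⟨v, hv, rfl⟩ := Finset.mem_image.1 hy
  by_contra hne
  obtain ⟨j, hj⟩ := h u hu v hv (fun e => hne (by rw [e]))
  refine M_ne h2 (h1 j) ?_
  unfold Tw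
  rw [hj, ph_compl]

theorem tf_Tw {d : ℕ} {V : Finset (Fin d → Fin 6)} (h : TwinPairFree compl6 V) :
    TF (V.image Tw) := by
  intro x hx j hy
  obtain ⟨u, hu, rfl⟩ := Finset.mem_image.1 hx
  obtain ⟨v, hv, e⟩ := Finset.mem_image.1 hy
  refine h u hu v hv ⟨j, ?_, fun i hi => ?_⟩
  · apply ph_inj
    have := congrFun e j
    rw [ph_compl]
    simpa [Tw] using this
  · apply ph_inj
    have := congrFun e i
    simpa [Tw, hi] using this.symm

theorem cnt_le_one {ι : Type} [Fintype ι] [DecidableEq ι] {X : Finset (ι → Lt)} (h : Code X) (z) :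
    cnt X.val z ≤ 1 := by
  unfold cnt
  rw [Multiset.countP_eq_card_filter]
  change (X.filter (fun w => M w z)).card ≤ 1
  rw [Finset.card_le_one]
  intro a ha b hb
  exact h a (Finset.mem_filter.1 ha).1 b (Finset.mem_filter.1 hb).1 z (Finset.mem_filter.1 ha).2
    (Finset.mem_filter.1 hb).2

theorem transfer {d : ℕ} {V W : Finset (Fin d → Fin 6)}
    (hVcode : PolyboxCode compl6 V) (hWcode : PolyboxCode compl6 W)
    (hVtp : TwinPairFree compl6 V) (hWtp : TwinPairFree compl6 W)
    (hdisj : Disjoint V W) (hequiv : EquivalentCodes compl6 V W)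
    (hcard : V.card ≤ 16) (hflat : ¬ IsFlat compl6 V) (i : Fin d) (l : Fin 6)
    (h : ∃ v ∈ V, v i = l) : ∃ v ∈ V, v i = compl6 l := by
  by_contra hno
  have hf : ∃ v ∈ V, v i ≠ l := by
    by_contra h2
    push Not at h2
    exact hflat ⟨i, l, h2⟩
  refine main' (V := V.image Tw) (W := W.image Tw) (i := i) (l := ph l) (code_Tw hVcode)
    (code_Tw hWcode) (tf_Tw hVtp) (tf_Tw hWtp) ?_ ?_ (le_trans Finset.card_image_le hcard) ?_ ?_ ?_
  · intro x hx hy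
    obtain ⟨u, hu, rfl⟩ := Finset.mem_image.1 hx
    obtain ⟨v, hv, e⟩ := Finset.mem_image.1 hy
    rw [Tw_inj e] at hv
    exact Finset.disjoint_left.1 hdisj hu hv
  · intro z
    have a1 := cnt_le_one (code_Tw hVcode) z
    have a2 := cnt_le_one (code_Tw hWcode) z
    have a3 : 0 < cnt (W.image Tw).val z ↔ 0 < cnt (V.image Tw).val z := by
      rw [cnt_pos, cnt_pos, cov_iff, cov_iff, show CodeReal compl6 V = CodeReal compl6 W from hequiv]
    omega
  · intro x hx e
    obtain ⟨u, hu, rfl⟩ := Finset.mem_image.1 hx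
    rw [← ph_compl] at e
    exact hno ⟨u, hu, ph_inj _ _ e⟩
  · obtain ⟨v, hv, e⟩ := h
    exact ⟨Tw v, Finset.mem_image_of_mem Tw hv, by unfold Tw; rw [e]⟩
  · obtain ⟨v, hv, e⟩ := hf
    exact ⟨Tw v, Finset.mem_image_of_mem Tw hv, fun e' => e (ph_inj _ _ e')⟩

end PB

/-- Let `d ∈ {5,6}` and let `V, W ⊆ {a,a',b,b',c,c'}^d` be disjoint equivalent
polybox codes without twin pairs, `|V| ∈ {13,...,16}`, `V` not flat. Then for every
`i ∈ [d]` and `l ∈ S`: if `V^{i,l} ∪ V^{i,l'} ≠ ∅`, then `V^{i,l} ≠ ∅` and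
`V^{i,l'} ≠ ∅`. -/
theorem both_letters_nonempty (d : ℕ) (hd : d = 5 ∨ d = 6)
    (V W : Finset (Fin d → Fin 6))
    (hVcode : PolyboxCode compl6 V) (hWcode : PolyboxCode compl6 W)
    (hVtp : TwinPairFree compl6 V) (hWtp : TwinPairFree compl6 W)
    (hdisj : Disjoint V W) (hequiv : EquivalentCodes compl6 V W)
    (hcard : 13 ≤ V.card ∧ V.card ≤ 16) (hflat : ¬ IsFlat compl6 V) :
    ∀ (i : Fin d) (l : Fin 6),
      (∃ v ∈ V, v i = l ∨ v i = compl6 l) →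
        (∃ v ∈ V, v i = l) ∧ (∃ v ∈ V, v i = compl6 l) := by
  intro i l
  rintro ⟨v, hv, h | h⟩
  · exact ⟨⟨v, hv, h⟩, PB.transfer hVcode hWcode hVtp hWtp hdisj hequiv hcard.2 hflat i l ⟨v, hv, h⟩⟩
  · refine ⟨?_, ⟨v, hv, h⟩⟩
    have := PB.transfer hVcode hWcode hVtp hWtp hdisj hequiv hcard.2 hflat i (compl6 l) ⟨v, hv, h⟩
    rwa [PB.compl_compl] at this
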